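/- No set is k-generational sum-dominant for all k: for every finite nonempty set of integers A, there exists a positive integer c₀ such that for all c ≥ c₀, |cA − cA| ≥ |cA + cA|. In particular, there is no finite set of integers A with |cA + cA| > |cA − cA| for every positive integer c. -/

import Mathlib

open Finset
open scoped Pointwise

/-- The `c`-fold sumset `cA = A + ⋯ + A` (`c` times), with `0A = {0}`. -/
def foldSum : ℕ → Finset ℤ → Finset ℤ
  | 0, _ => {0}
  | s + 1, A => A + foldSum s A

theorem fs_mem_succ (k : ℕ) (A : Finset ℤ) (x : ℤ) :
    x ∈ foldSum (k + 1) A ↔ ∃ a ∈ A, ∃ y ∈ foldSum k A, a + y = x := by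
  simp [foldSum, Finset.mem_add]

theorem fs_add (A : Finset ℤ) (k l : ℕ) :
    foldSum (k + l) A = foldSum k A + foldSum l A := by
  induction k with
  | zero =>
    have : foldSum 0 A = 0 := rfl
    rw [this, zero_add, zero_add]
  | succ k ih =>
    have h1 : foldSum (k + 1) A = A + foldSum k A := rfl
    have h2 : foldSum (k + 1 + l) A = A + foldSum (k + l) A := by
      rw [show k + 1 + l = (k + l) + 1 by ring]; rfl
    rw [h1, h2, ih, add_assoc]

theorem fs_const (A : Finset ℤ) (a : ℤ) (ha : a ∈ A) (k : ℕ) : (k : ℤ) * a ∈ foldSum k A := by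
  induction k with
  | zero => simp [foldSum]
  | succ k ih =>
    rw [fs_mem_succ]
    exact ⟨a, ha, _, ih, by push_cast; ring⟩

theorem fs_neg (A : Finset ℤ) (k : ℕ) : foldSum k (-A) = -foldSum k A := by
  induction k with
  | zero => simp [foldSum]
  | succ k ih =>
    have h1 : ∀ B, foldSum (k + 1) B = B + foldSum k B := fun _ => rfl
    rw [h1, h1, ih, neg_add]

theorem fs_lower (A : Finset ℤ) (a0 : ℤ) (h : ∀ a ∈ A, a0 ≤ a) (k : ℕ) :
    ∀ x ∈ foldSum k A, (k : ℤ) * a0 ≤ x := by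
  induction k with
  | zero => simp [foldSum]
  | succ k ih =>
    intro x hx
    rw [fs_mem_succ] at hx
    obtain ⟨a, ha, y, hy, rfl⟩ := hx
    have := ih y hy
    have := h a ha
    push_cast
    linarith

theorem fs_dvd (A : Finset ℤ) (a0 : ℤ) (e : ℤ) (h : ∀ a ∈ A, e ∣ a - a0) (k : ℕ) :
    ∀ x ∈ foldSum k A, e ∣ x - (k : ℤ) * a0 := by
  induction k with
  | zero => simp [foldSum]
  | succ k ih =>
    intro x hx
    rw [fs_mem_succ] at hx
    obtain ⟨a, ha, y, hy, rfl⟩ := hx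
    have := dvd_add (h a ha) (ih y hy)
    have e1 : a + y - ((k + 1 : ℕ) : ℤ) * a0 = a - a0 + (y - (k : ℤ) * a0) := by
      push_cast
      ring
    rw [e1]
    exact this

/-- the semigroup of `A - a0` -/
def semiP (A : Finset ℤ) (a0 : ℤ) (y : ℕ) : Prop := ∃ k : ℕ, (y : ℤ) + k * a0 ∈ foldSum k A

/-- divisibility by the gcd of differences -/
def semiQ (A : Finset ℤ) (y : ℕ) : Prop :=
  ∀ e : ℕ, (∀ a ∈ A, ∀ b ∈ A, (e : ℤ) ∣ a - b) → e ∣ y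

theorem semiQ_neg (A : Finset ℤ) (y : ℕ) : semiQ (-A) y ↔ semiQ A y := by
  have : ∀ e : ℕ, (∀ a ∈ -A, ∀ b ∈ -A, (e : ℤ) ∣ a - b) ↔ (∀ a ∈ A, ∀ b ∈ A, (e : ℤ) ∣ a - b) := by
    intro e
    constructor
    · intro h a ha b hb
      have := h (-b) (by simpa using hb) (-a) (by simpa using ha)
      convert this using 1; ring
    · intro h a ha b hb
      have := h (-b) (by simpa using hb) (-a) (by simpa using ha)
      convert this using 1; ring
  simp only [semiQ, this]

theorem semiP_Q (A : Finset ℤ) (a0 : ℤ) (h0 : a0 ∈ A) (y : ℕ) (h : semiP A a0 y) : semiQ A y := by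
  obtain ⟨k, hk⟩ := h
  intro e he
  have := fs_dvd A a0 e (fun a ha => he a ha a0 h0) k _ hk
  rw [add_sub_cancel_right] at this
  exact_mod_cast this

theorem semiP_ev (A : Finset ℤ) (a0 : ℤ) (h0 : a0 ∈ A) (hl : ∀ a ∈ A, a0 ≤ a) :
    ∃ M : ℕ, ∀ y ≥ M, semiP A a0 y ↔ semiQ A y := by
  obtain ⟨M, hM⟩ := Nat.exists_mem_closure_of_ge {n : ℕ | a0 + n ∈ A}
  refine ⟨M, fun y hy => ⟨semiP_Q A a0 h0 y, fun hQ => ?_⟩⟩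
  have hd : Nat.setGcd {n : ℕ | a0 + n ∈ A} ∣ y := by
    apply hQ
    have key : ∀ a ∈ A, ((Nat.setGcd {n : ℕ | a0 + n ∈ A} : ℕ) : ℤ) ∣ a - a0 := by
      intro a ha
      obtain ⟨n, hn⟩ := Int.eq_ofNat_of_zero_le (sub_nonneg.2 (hl a ha))
      rw [hn, Int.natCast_dvd_natCast]
      apply Nat.setGcd_dvd_of_mem
      show a0 + (n : ℤ) ∈ A
      rw [← hn]; simpa using ha
    intro a ha b hb
    have := dvd_sub (key a ha) (key b hb)
    simpa using this
  refine AddSubmonoid.closure_induction (motive := fun y _ => semiP A a0 y) ?_ ?_ ?_ (hM y hy hd)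
  · intro n hn
    refine ⟨1, ?_⟩
    rw [fs_mem_succ]
    exact ⟨a0 + n, hn, 0, by simp [foldSum], by push_cast; ring⟩
  · exact ⟨0, by simp [foldSum]⟩
  · rintro x y - - ⟨k, hk⟩ ⟨l, hl⟩
    refine ⟨k + l, ?_⟩
    rw [fs_add]
    convert Finset.add_mem_add hk hl using 1
    push_cast; ring

theorem fs_mono (A : Finset ℤ) (a0 : ℤ) (h0 : a0 ∈ A) (k l : ℕ) (hkl : k ≤ l) (y : ℤ)
    (hy : y + k * a0 ∈ foldSum k A) : y + l * a0 ∈ foldSum l A := by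
  obtain ⟨j, rfl⟩ := Nat.exists_eq_add_of_le hkl
  rw [fs_add]
  convert Finset.add_mem_add hy (fs_const A a0 h0 j) using 1
  push_cast; ring

theorem fs_unif (A : Finset ℤ) (a0 : ℤ) (h0 : a0 ∈ A) (K : ℕ) :
    ∃ c0 : ℕ, ∀ y < K, semiP A a0 y → (y : ℤ) + c0 * a0 ∈ foldSum c0 A := by
  induction K with
  | zero => exact ⟨0, by simp⟩
  | succ K ih =>
    obtain ⟨c, hc⟩ := ih
    by_cases hK : semiP A a0 K
    · obtain ⟨k, hk⟩ := hK
      refine ⟨max c k, fun y hy hP => ?_⟩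
      rcases Nat.lt_succ_iff_lt_or_eq.1 hy with h | h
      · exact fs_mono A a0 h0 c _ (le_max_left _ _) _ (hc y h hP)
      · subst h
        exact fs_mono A a0 h0 k _ (le_max_right _ _) _ hk
    · refine ⟨c, fun y hy hP => ?_⟩
      rcases Nat.lt_succ_iff_lt_or_eq.1 hy with h | h
      · exact hc y h hP
      · subst h; exact absurd hP hK

theorem fs_diff (A : Finset ℤ) (a0 : ℤ) (m : ℕ) (hm : 0 < m) (h0 : a0 ∈ A) (h1 : a0 + m ∈ A)
    (hl : ∀ a ∈ A, a0 ≤ a) :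
    ∃ c0 : ℕ, ∀ c ≥ c0, ∀ y : ℕ, semiP A a0 y → y ≤ c * m →
      (y : ℤ) - c * m ∈ foldSum c A - foldSum c A := by
  obtain ⟨M, hM⟩ := semiP_ev A a0 h0 hl
  obtain ⟨c0, hc0⟩ := fs_unif A a0 h0 (M + m)
  refine ⟨c0, fun c hc y hy hyc => ?_⟩
  have key : ∀ y : ℕ, semiP A a0 y → ∃ j u : ℕ, y = u + j * m ∧ (u : ℤ) + c0 * a0 ∈ foldSum c0 A := by
    intro y
    induction y using Nat.strong_induction_on with
    | _ y ih =>
      intro hP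
      by_cases hlt : y < M + m
      · exact ⟨0, y, by simp, hc0 y hlt hP⟩
      · have hPm : semiP A a0 (y - m) := by
          rw [hM _ (by omega)]
          intro e he
          have h2 := semiP_Q A a0 h0 y hP e he
          have h3 := he _ h1 _ h0
          have h4 : e ∣ m := by simpa [Int.natCast_dvd_natCast] using h3
          exact Nat.dvd_sub h2 h4
        obtain ⟨j, u, hj, hu⟩ := ih (y - m) (by omega) hPm
        refine ⟨j + 1, u, ?_, hu⟩
        rw [add_mul, one_mul]; omega
  obtain ⟨j, u, hj, hu⟩ := key y hy
  have hjc : j ≤ c := by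
    have : j * m ≤ c * m := by omega
    exact Nat.le_of_mul_le_mul_right this hm
  obtain ⟨i, rfl⟩ := Nat.exists_eq_add_of_le hjc
  have e1 := fs_mono A a0 h0 c0 (j + i) hc _ hu
  have e2 : ((i : ℤ) * m) + (j + i : ℕ) * a0 ∈ foldSum (j + i) A := by
    rw [fs_add]
    convert Finset.add_mem_add (fs_const A a0 h0 j) (fs_const A _ h1 i) using 1
    push_cast; ring
  convert Finset.sub_mem_sub e1 e2 using 1
  rw [hj]; push_cast; ring

open Classical in
theorem card_diff_ge (A : Finset ℤ) (a0 : ℤ) (m : ℕ) (hm : 0 < m) (h0 : a0 ∈ A) (h1 : a0 + m ∈ A)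
    (hl : ∀ a ∈ A, a0 ≤ a) :
    ∃ c0 : ℕ, ∀ c ≥ c0,
      ((range (2 * (c * m) + 1)).filter
        (fun y => semiP A a0 y ∧ semiP A a0 (2 * (c * m) - y))).card
      ≤ (foldSum c A - foldSum c A).card := by
  obtain ⟨c0, hc0⟩ := fs_diff A a0 m hm h0 h1 hl
  refine ⟨c0, fun c hc => ?_⟩
  refine Finset.card_le_card_of_injOn (fun y : ℕ => (y : ℤ) - c * m) ?_ ?_
  · intro y hy
    simp only [Finset.coe_filter, Finset.mem_range, Set.mem_ofPred_eq] at hy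
    obtain ⟨hr, hp, hp'⟩ := hy
    rcases le_total y (c * m) with h | h
    · exact hc0 c hc y hp h
    · have := hc0 c hc _ hp' (by omega)
      obtain ⟨p, hp, q, hq, hpq⟩ := Finset.mem_sub.1 this
      refine Finset.mem_coe.2 (Finset.mem_sub.2 ⟨q, hq, p, hp, ?_⟩)
      push_cast [Nat.cast_sub (show y ≤ 2 * (c * m) by omega)] at hpq
      linarith
  · intro x _ y _ hxy
    simpa using hxy

open Classical in
theorem card_sum_le (A : Finset ℤ) (a0 : ℤ) (m : ℕ)
    (hl : ∀ a ∈ A, a0 ≤ a) (hu : ∀ a ∈ A, a ≤ a0 + m) (c : ℕ) :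
    (foldSum c A + foldSum c A).card ≤
      ((range (2 * (c * m) + 1)).filter
        (fun y => semiP A a0 y ∧ semiP (-A) (-(a0 + m)) (2 * (c * m) - y))).card := by
  rw [← fs_add]
  have hlo := fs_lower A a0 hl (c + c)
  have hhi : ∀ x ∈ foldSum (c + c) A, x ≤ ((c + c : ℕ) : ℤ) * (a0 + m) := by
    intro x hx
    have := fs_lower (-A) (-(a0 + m)) (fun a ha => by
      have := hu (-a) (by simpa using ha)
      linarith) (c + c) (-x) (by rw [fs_neg]; simpa using hx)
    linarith
  refine Finset.card_le_card_of_injOn (fun x : ℤ => (x - ((c + c : ℕ) : ℤ) * a0).toNat) ?_ ?_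
  · intro x hx
    have hx' : x ∈ foldSum (c + c) A := hx
    have g1 := hlo x hx'
    have g2 := hhi x hx'
    obtain ⟨n, hn⟩ := Int.eq_ofNat_of_zero_le (sub_nonneg.2 g1)
    have hle : n ≤ 2 * (c * m) := by
      zify
      push_cast at *
      linarith
    simp only [Finset.coe_filter, Finset.mem_range, Set.mem_ofPred_eq, hn, Int.toNat_natCast]
    refine ⟨by omega, ⟨c + c, ?_⟩, ⟨c + c, ?_⟩⟩
    · rw [← hn]; simpa using hx'
    · rw [fs_neg, Finset.mem_neg']
      convert hx' using 1
      push_cast [Nat.cast_sub hle]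
      push_cast at hn
      linarith
  · intro x hx y hy hxy
    have := hlo x hx
    have := hlo y hy
    simp only at hxy
    omega

open Classical in
theorem comb (P P' : ℕ → Prop) (M N : ℕ) (hN : 2 * M ≤ N) (h : ∀ y ≥ M, P y ↔ P' y) :
    2 * ((range (N + 1)).filter (fun y => P y ∧ P' (N - y))).card ≤
      ((range (N + 1)).filter (fun y => P y ∧ P (N - y))).card +
      ((range (N + 1)).filter (fun y => P' y ∧ P' (N - y))).card := by
  have hflip : ((range (N + 1)).filter (fun y => P y ∧ P' (N - y))).card =
      ((range (N + 1)).filter (fun y => P' y ∧ P (N - y))).card := by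
    rw [Finset.card_filter, Finset.card_filter, ← Finset.sum_flip]
    refine Finset.sum_congr rfl fun y hy => ?_
    have : N - (N - y) = y := by have := Finset.mem_range.1 hy; omega
    simp only [this, and_comm]
  rw [two_mul]
  nth_rewrite 2 [hflip]
  simp only [Finset.card_filter]
  rw [← Finset.sum_add_distrib, ← Finset.sum_add_distrib]
  refine Finset.sum_le_sum fun y hy => ?_
  have hy' := Finset.mem_range.1 hy
  rcases le_total M y with h1 | h1
  · have := h y h1
    simp only [this]; omega
  · have := h (N - y) (by omega)
    simp only [this]; omega

theorem main_part (A : Finset ℤ) (hA : A.Nonempty) : ∃ c₀ : ℕ, 0 < c₀ ∧ ∀ c : ℕ, c₀ ≤ c →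
      (foldSum c A + foldSum c A).card ≤ (foldSum c A - foldSum c A).card := by
  classical
  have h0 := A.min'_mem hA
  have h1 := A.max'_mem hA
  have hl : ∀ a ∈ A, A.min' hA ≤ a := fun a ha => A.min'_le a ha
  have hu : ∀ a ∈ A, a ≤ A.max' hA := fun a ha => A.le_max' a ha
  generalize A.min' hA = a0 at *
  generalize A.max' hA = a1 at *
  obtain ⟨m, hm⟩ := Int.eq_ofNat_of_zero_le (sub_nonneg.2 (hl a1 h1))
  obtain rfl : a1 = a0 + m := by linarith
  rcases Nat.eq_zero_or_pos m with rfl | hm0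
  · refine ⟨1, one_pos, fun c _ => ?_⟩
    have hc := card_sum_le A a0 0 hl hu c
    have h2 : (foldSum c A - foldSum c A).Nonempty :=
      ⟨_, Finset.sub_mem_sub (fs_const A a0 h0 c) (fs_const A a0 h0 c)⟩
    have h3 := h2.card_pos
    classical
    refine hc.trans (le_trans (Finset.card_le_card (Finset.filter_subset _ _)) ?_)
    simpa using h3
  · have n0 : -(a0 + m) ∈ -A := by simpa using h1
    have n1 : -(a0 + m) + m ∈ -A := by simpa using h0
    have nl : ∀ a ∈ -A, -(a0 + m) ≤ a := fun a ha => by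
      have := hu (-a) (by simpa using ha)
      linarith
    obtain ⟨c1, hc1⟩ := card_diff_ge A a0 m hm0 h0 h1 hl
    obtain ⟨c2, hc2⟩ := card_diff_ge (-A) (-(a0 + m)) m hm0 n0 n1 nl
    obtain ⟨M1, hM1⟩ := semiP_ev A a0 h0 hl
    obtain ⟨M2, hM2⟩ := semiP_ev (-A) (-(a0 + m)) n0 nl
    refine ⟨c1 + c2 + M1 + M2 + 1, by omega, fun c hc => ?_⟩
    have e1 := hc1 c (by omega)
    have e2 := hc2 c (by omega)
    have e3 := card_sum_le A a0 m hl hu c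
    have hcm : c ≤ c * m := Nat.le_mul_of_pos_right c hm0
    have e4 := comb (semiP A a0) (semiP (-A) (-(a0 + m))) (M1 + M2) (2 * (c * m)) (by omega)
      (fun y hy => by rw [hM1 y (by omega), hM2 y (by omega), semiQ_neg])
    have e5 : (foldSum c (-A) - foldSum c (-A)).card = (foldSum c A - foldSum c A).card := by
      rw [fs_neg, ← Finset.card_neg (foldSum c A - foldSum c A)]
      congr 1
      simp [sub_eq_add_neg, add_comm]
    omega

/-- Iyer–Lazarev–Miller–Zhang: no set is `k`-generational sum-dominant for all `k`.  For
every finite nonempty set of integers `A` there is a positive integer `c₀` such that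
`|cA - cA| ≥ |cA + cA|` for all `c ≥ c₀`; in particular there is no finite set of
integers with `|cA + cA| > |cA - cA|` for every positive integer `c`. -/
theorem no_all_generational_set :
    (∀ A : Finset ℤ, A.Nonempty → ∃ c₀ : ℕ, 0 < c₀ ∧ ∀ c : ℕ, c₀ ≤ c →
      (foldSum c A + foldSum c A).card ≤ (foldSum c A - foldSum c A).card) ∧
    ¬∃ A : Finset ℤ, ∀ c : ℕ, 0 < c →
      (foldSum c A - foldSum c A).card < (foldSum c A + foldSum c A).card := by
  refine ⟨main_part, ?_⟩
  rintro ⟨A, hA⟩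
  rcases A.eq_empty_or_nonempty with rfl | hne
  · have := hA 1 one_pos
    simp [foldSum] at this
  · obtain ⟨c, hc, h⟩ := main_part A hne
    exact absurd (hA c hc) (not_lt.2 (h c le_rfl))
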